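/- arXiv:2311.13936 — 4 statements merged into one kernel-verified Lean document; each statement's English description precedes it below -/
import Mathlib

section
/- The trace language L of a shared Petri net with transition rights satisfies the three Process-Commutative-Object language properties: (i) Initial emptiness: the empty word belongs to L (since marking(ε) = M0 is nonnegative); (ii) C*-closure: for every word v ∈ L and every transition t ∈ T_C, v ⊕ fire_t ∈ L; (iii) I-diamond closure: for every word v ∈ L, every process index i, every transition t_i ∈ T_i, and every word z over Σ \ O_i, if v ⊕ fire_{t_i} ∈ L and v ⊕ z ∈ L, then v ⊕ z ⊕ fire_{t_i} ∈ L. -/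
/-!
Shared Petri net with transition rights.

Places `P`, transitions `T`, initial marking `M0 : P → ℕ`, weights
`Wm : T → P → ℕ` (consumed) and `Wp : T → P → ℕ` (produced);
`N⁻(t) = { p | Wm t p > 0 }`.

A word of fire operations is a `List T` (the letter `fire_t` is identified
with `t`).  The partition `T = T_C ∪ T_1 ∪ … ∪ T_n` is encoded by
`owner : T → Option (Fin n)` (`owner t = none` means `t ∈ T_C`,
`owner t = some i` means `t ∈ T_i`), with:
* `hC`: every `t ∈ T_C` has no input place;
* `hconf`: each `T_i` is closed under the conflict relation `⋄`
  (hence under its reflexive–transitive closure `⋄⁺`).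

`marking v p = M0 p + Σ_{t ∈ v} (W⁺(t,p) − W⁻(t,p))` and
`L = { v | ∀ p, marking v p ≥ 0 }`.
-/

/-- The marking of place `p` after the word of fire operations `v`. -/
def marking {P T : Type*} (M0 : P → ℕ) (Wp Wm : T → P → ℕ)
    (v : List T) (p : P) : ℤ :=
  (M0 p : ℤ) + (v.map (fun t => (Wp t p : ℤ) - (Wm t p : ℤ))).sum

/-- The trace language `L` of the shared Petri net. -/
def pnL {P T : Type*} (M0 : P → ℕ) (Wp Wm : T → P → ℕ) (v : List T) : Prop :=
  ∀ p : P, 0 ≤ marking M0 Wp Wm v p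

/-- The language `L` of a shared Petri net with transition rights satisfies
(i) initial emptiness, (ii) `C*`-closure, and (iii) `I`-diamond closure. -/
theorem petri_language_is_PCO {P T : Type*} {n : ℕ}
    (M0 : P → ℕ) (Wp Wm : T → P → ℕ)
    (owner : T → Option (Fin n))
    -- every transition of `T_C` has no input place
    (hC : ∀ t : T, owner t = none → ∀ p : P, Wm t p = 0)
    -- each `T_i` is closed under the conflict relation `⋄` (hence under `⋄⁺`)
    (hconf : ∀ (t t' : T) (i : Fin n),
      (∃ p : P, 0 < Wm t p ∧ 0 < Wm t' p) →
      owner t = some i → owner t' = some i) :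
    -- (i) Initial emptiness
    pnL M0 Wp Wm ([] : List T) ∧
    -- (ii) C*-closure: firing a common transition preserves L
    (∀ v : List T, pnL M0 Wp Wm v →
      ∀ t : T, owner t = none → pnL M0 Wp Wm (v ++ [t])) ∧
    -- (iii) I-diamond closure
    (∀ v : List T, pnL M0 Wp Wm v →
      ∀ (i : Fin n) (ti : T), owner ti = some i →
      ∀ z : List T, (∀ t ∈ z, owner t ≠ some i) →
        pnL M0 Wp Wm (v ++ [ti]) → pnL M0 Wp Wm (v ++ z) →
        pnL M0 Wp Wm (v ++ z ++ [ti])) := by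
  refine ⟨?_, ?_, ?_⟩
  · intro p
    simp [marking]
  · intro v hv t ht p
    have h := hv p
    have h0 := hC t ht p
    simp only [marking, List.map_append, List.sum_append, List.map_cons, List.map_nil,
      List.sum_cons, List.sum_nil] at h ⊢
    omega
  · intro v _ i ti hti z hz h1 h2 p
    have h1 := h1 p
    have h2 := h2 p
    simp only [marking, List.map_append, List.sum_append, List.map_cons, List.map_nil,
      List.sum_cons, List.sum_nil] at h1 h2 ⊢
    by_cases h0 : Wm ti p = 0
    · omega
    · have h3 : 0 ≤ (z.map (fun t => (Wp t p : ℤ) - (Wm t p : ℤ))).sum := by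
        apply List.sum_nonneg
        intro x hx
        obtain ⟨t, ht, rfl⟩ := List.mem_map.1 hx
        have h4 : Wm t p = 0 := by
          by_contra h5
          exact hz t ht (hconf ti t i ⟨p, Nat.pos_of_ne_zero h0, Nat.pos_of_ne_zero h5⟩ hti)
        omega
      omega
end

section
/- The trace language L of a money-transfer object satisfies the three Process-Commutative-Object language properties: (i) Initial emptiness: the empty word belongs to L (since each acc(i, ε) = init_i ≥ 0); (ii) C*-closure: for every word v ∈ L, every account index i, and every amount x ≥ 0, v ⊕ mint_{i,x} ∈ L; (iii) I-diamond closure: for every word v ∈ L, every transfer operation transfer_{i,j,x} with x ≥ 0, and every word z over Σ \ O_i, if v ⊕ transfer_{i,j,x} ∈ L and v ⊕ z ∈ L, then v ⊕ z ⊕ transfer_{i,j,x} ∈ L. -/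
/-!
Money-transfer object with `n` processes, initial balances `init i ≥ 0`.
Alphabet `Σ`: common updates `mint i x` (`x ≥ 0`) and process-exclusive
updates `O_i = { transfer i j x | j, x ≥ 0 }` (`transfer i j x` is issued by
process `i`).

`plus(i,v)` sums incoming transfers to `i` and mints into `i`'s account,
`minus(i,v)` sums outgoing transfers from `i`, and
`acc(i,v) = init i + plus(i,v) − minus(i,v)`.
The language is `L = { v | ∀ i, acc(i,v) ≥ 0 }`.
-/

inductive MTOp (n : ℕ) where
  | mint : Fin n → ℝ → MTOp n
  | transfer : Fin n → Fin n → ℝ → MTOp n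

/-- Amount credited to account `i` by a single letter. -/
def plusOf {n : ℕ} (i : Fin n) : MTOp n → ℝ
  | .mint k x => if k = i then x else 0
  | .transfer _ j x => if j = i then x else 0

/-- Amount debited from account `i` by a single letter. -/
def minusOf {n : ℕ} (i : Fin n) : MTOp n → ℝ
  | .mint _ _ => 0
  | .transfer k _ x => if k = i then x else 0

/-- The balance `acc(i, v)` of account `i` after the word `v`. -/
def acc {n : ℕ} (init : Fin n → ℝ) (i : Fin n) (v : List (MTOp n)) : ℝ :=
  init i + (v.map (plusOf i)).sum - (v.map (minusOf i)).sum

/-- Membership of a letter in the alphabet `Σ` (amounts are nonnegative). -/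
def inSig {n : ℕ} : MTOp n → Prop
  | .mint _ x => 0 ≤ x
  | .transfer _ _ x => 0 ≤ x

/-- The letter is an operation exclusive to process `i` (a transfer issued
by `i`), i.e. belongs to `O_i`. -/
def issuedBy {n : ℕ} (i : Fin n) : MTOp n → Prop
  | .mint _ _ => False
  | .transfer k _ _ => k = i

/-- The trace language `L` of a money-transfer object. -/
def mtL {n : ℕ} (init : Fin n → ℝ) (v : List (MTOp n)) : Prop :=
  ∀ i : Fin n, 0 ≤ acc init i v

theorem aux_sums {n : ℕ} (i : Fin n) (z : List (MTOp n))
    (hz : ∀ a ∈ z, inSig a ∧ ¬ issuedBy i a) :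
    0 ≤ (z.map (plusOf i)).sum ∧ (z.map (minusOf i)).sum = 0 := by
  induction z with
  | nil => simp
  | cons a t ih =>
    obtain ⟨h1, h2⟩ := ih (fun b hb => hz b (List.mem_cons_of_mem _ hb))
    obtain ⟨h3, h4⟩ := hz a List.mem_cons_self
    simp only [List.map_cons, List.sum_cons]
    cases a with
    | mint k x =>
      simp only [inSig] at h3
      simp only [plusOf, minusOf]
      split_ifs <;> constructor <;> linarith
    | transfer k l x =>
      simp only [inSig] at h3
      simp only [issuedBy] at h4
      simp only [plusOf, minusOf, if_neg h4]
      split_ifs <;> constructor <;> linarith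

/-- The language `L` of a money-transfer object satisfies (i) initial
emptiness, (ii) `C*`-closure, and (iii) `I`-diamond closure. -/
theorem money_transfer_language_is_PCO {n : ℕ}
    (init : Fin n → ℝ) (hinit : ∀ i, 0 ≤ init i) :
    -- (i) Initial emptiness
    mtL init ([] : List (MTOp n)) ∧
    -- (ii) C*-closure: appending any mint operation preserves L
    (∀ v : List (MTOp n), (∀ a ∈ v, inSig a) → mtL init v →
      ∀ (i : Fin n) (x : ℝ), 0 ≤ x → mtL init (v ++ [MTOp.mint i x])) ∧
    -- (iii) I-diamond closure
    (∀ v : List (MTOp n), (∀ a ∈ v, inSig a) → mtL init v →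
      ∀ (i j : Fin n) (x : ℝ), 0 ≤ x →
      ∀ z : List (MTOp n), (∀ a ∈ z, inSig a ∧ ¬ issuedBy i a) →
        mtL init (v ++ [MTOp.transfer i j x]) → mtL init (v ++ z) →
        mtL init (v ++ z ++ [MTOp.transfer i j x])) := by
  refine ⟨?_, ?_, ?_⟩
  · intro i
    simpa [acc] using hinit i
  · intro v _ hv i x hx k
    have h := hv k
    simp only [acc, List.map_append, List.sum_append, List.map_cons, List.map_nil,
      List.sum_cons, List.sum_nil, plusOf, minusOf] at h ⊢
    split_ifs <;> linarith
  · intro v _ _ i j x hx z hz h1 h2 k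
    have h1 := h1 k
    have h2 := h2 k
    simp only [acc, List.map_append, List.sum_append, List.map_cons, List.map_nil,
      List.sum_cons, List.sum_nil, plusOf, minusOf] at h1 h2 ⊢
    by_cases hk : i = k
    · subst hk
      obtain ⟨h3, h4⟩ := aux_sums i z hz
      linarith
    · rw [if_neg hk] at h1 ⊢
      split_ifs at h1 ⊢ <;> linarith
end

section
/- Characterization of trace equivalence for the process-commutative independence relation: two finite words u, v over Σ satisfy u ∼_I v if and only if (i) every common update a ∈ C occurs the same number of times in u as in v, and (ii) for every process index i, proj_{O_i}(u) = proj_{O_i}(v). (This characterization underlies the paper's argument that two serializations containing the same updates and respecting each process's local order determine the same Mazurkiewicz trace, establishing Strong Eventual Consistency.) -/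
/-!
Generic alphabet of update operations `Σ = C ∪ O_1 ∪ … ∪ O_n` with `C` and
the `O_i` pairwise disjoint, encoded by a classification
`c : α → Option (Fin n)` on the alphabet type `α`: `c a = none` means
`a ∈ C`, and `c a = some i` means `a ∈ O_i`.

The independence relation is `I = (Σ × Σ) \ ⋃_i (O_i × O_i)`, and trace
equivalence `∼_I` is generated by swapping adjacent independent letters.
-/

/-- `(a, b) ∈ I`: the two letters do not belong to the same `O_i`. -/
def indep {α : Type*} {n : ℕ} (c : α → Option (Fin n)) (a b : α) : Prop :=
  ¬ ∃ i : Fin n, c a = some i ∧ c b = some i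

/-- A single swap of two adjacent independent letters. -/
inductive TraceStep {α : Type*} {n : ℕ} (c : α → Option (Fin n)) :
    List α → List α → Prop
  | swap (u w : List α) (a b : α) (h : indep c a b) :
      TraceStep c (u ++ a :: b :: w) (u ++ b :: a :: w)

/-- Trace equivalence `u ∼_I v`: `u` can be transformed into `v` by finitely
many swaps of adjacent independent letters. -/
def TraceEq {α : Type*} {n : ℕ} (c : α → Option (Fin n)) :
    List α → List α → Prop :=
  Relation.ReflTransGen (TraceStep c)

/-- `proj_{O_i}(w)`: the subword of `w` consisting of its letters in `O_i`. -/
def projO {α : Type*} {n : ℕ} (c : α → Option (Fin n)) (i : Fin n)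
    (w : List α) : List α :=
  w.filter (fun a => decide (c a = some i))

theorem traceEq_cons {α : Type*} {n : ℕ} {c : α → Option (Fin n)} (x : α)
    {u v : List α} (h : TraceEq c u v) : TraceEq c (x :: u) (x :: v) := by
  refine Relation.ReflTransGen.lift (fun l => x :: l) ?_ _ _ h
  rintro _ _ ⟨p, w, a, b, hab⟩
  exact TraceStep.swap (x :: p) w a b hab

theorem traceEq_pull {α : Type*} {n : ℕ} {c : α → Option (Fin n)} (a : α)
    (p s : List α) (h : ∀ x ∈ p, indep c a x) :
    TraceEq c (a :: (p ++ s)) (p ++ a :: s) := by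
  induction p with
  | nil => exact Relation.ReflTransGen.refl
  | cons x p ih =>
    exact Relation.ReflTransGen.head (TraceStep.swap [] (p ++ s) a x (h x (by simp)))
      (traceEq_cons x (ih fun y hy => h y (by simp [hy])))

theorem traceEq_forward {α : Type*} [DecidableEq α] {n : ℕ}
    {c : α → Option (Fin n)} {u v : List α} (h : TraceEq c u v) :
    (∀ a : α, u.count a = v.count a) ∧ ∀ i : Fin n, projO c i u = projO c i v := by
  induction h with
  | refl => simp
  | tail _ hs ih =>
    obtain ⟨p, w, a, b, hab⟩ := hs
    refine ⟨fun x => (ih.1 x).trans ?_, fun i => (ih.2 i).trans ?_⟩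
    · exact (List.Perm.append_left p (List.Perm.swap b a w)).count_eq x
    · unfold projO
      by_cases ha : c a = some i
      · have hb : c b ≠ some i := fun hb => hab ⟨i, ha, hb⟩
        simp [ha, hb]
      · simp [List.filter_cons, ha]

theorem traceEq_backward {α : Type*} [DecidableEq α] {n : ℕ}
    (c : α → Option (Fin n)) (u : List α) : ∀ v : List α,
      (∀ a : α, c a = none → u.count a = v.count a) →
      (∀ i : Fin n, projO c i u = projO c i v) → TraceEq c u v := by
  induction u with
  | nil =>
    intro v h1 h2
    cases v with
    | nil => exact Relation.ReflTransGen.refl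
    | cons x v =>
      exfalso
      cases hx : c x with
      | none => simpa using h1 x hx
      | some i => simpa [projO, hx] using h2 i
  | cons a u ih =>
    intro v h1 h2
    obtain ⟨p, s, rfl, hp⟩ : ∃ p s, v = p ++ a :: s ∧ ∀ x ∈ p, indep c a x := by
      cases ha : c a with
      | none =>
        have hmem : a ∈ v := by
          rw [← List.count_pos_iff, ← h1 a ha]
          simp
        obtain ⟨p, s, rfl⟩ := List.append_of_mem hmem
        exact ⟨p, s, rfl, fun x _ ⟨i, hi, _⟩ => by simp [ha] at hi⟩
      | some i =>
        have h := h2 i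
        simp only [projO, List.filter_cons, ha, decide_true, if_true] at h
        obtain ⟨p, s, rfl, hp, _⟩ := List.filter_eq_cons_iff.1 h.symm
        refine ⟨p, s, rfl, fun x hx ⟨j, hj, hxj⟩ => hp x hx ?_⟩
        rw [ha] at hj
        simp [hxj, hj]
    have hpull := traceEq_pull a p s hp
    have hf := traceEq_forward hpull
    refine Relation.ReflTransGen.trans (traceEq_cons a (ih (p ++ s) ?_ ?_)) hpull
    · intro x hx
      have := (h1 x hx).trans (hf.1 x).symm
      simpa only [List.count_cons, Nat.add_right_cancel_iff] using this
    · intro i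
      have := (h2 i).trans (hf.2 i).symm
      simp only [projO, List.filter_cons] at this ⊢
      split at this
      · exact (List.cons.inj this).2
      · exact this

/-- Characterization of trace equivalence for the process-commutative
independence relation: `u ∼_I v` iff (i) every common update `a ∈ C` occurs
the same number of times in `u` and `v`, and (ii) for every process `i`,
`proj_{O_i}(u) = proj_{O_i}(v)`. -/
theorem traceEq_iff_counts_and_projections {α : Type*} [DecidableEq α] {n : ℕ}
    (c : α → Option (Fin n)) (u v : List α) :
    TraceEq c u v ↔
      ((∀ a : α, c a = none → u.count a = v.count a) ∧
        ∀ i : Fin n, projO c i u = projO c i v) := by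
  constructor
  · intro h
    exact ⟨fun a _ => (traceEq_forward h).1 a, (traceEq_forward h).2⟩
  · rintro ⟨h1, h2⟩
    exact traceEq_backward c u v h1 h2
end

section
/- The marking of an input place of a transition t_i ∈ T_i cannot decrease under fire operations not exclusive to process i: let t_i ∈ T_i, let p ∈ N⁻(t_i) be an input place of t_i, and let z be a finite word over Σ \ O_i. Then every transition t' fired in z satisfies p ∉ N⁻(t'), and consequently marking(v ⊕ z)(p) ≥ marking(v)(p) for every finite word v over Σ. -/
/-- Let `t_i ∈ T_i`, `p ∈ N⁻(t_i)`, and `z` a word over `Σ \ O_i`.  Then no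
transition fired in `z` has `p` as input place, and consequently
`marking (v ⊕ z) p ≥ marking v p` for every word `v`. -/
theorem marking_input_place_mono {P T : Type*} {n : ℕ}
    (M0 : P → ℕ) (Wp Wm : T → P → ℕ)
    (owner : T → Option (Fin n))
    -- each `T_j` is closed under the conflict relation `⋄` (hence under `⋄⁺`)
    (hconf : ∀ (t t' : T) (j : Fin n),
      (∃ q : P, 0 < Wm t q ∧ 0 < Wm t' q) →
      owner t = some j → owner t' = some j)
    (i : Fin n) (ti : T) (hti : owner ti = some i)
    (p : P) (hp : 0 < Wm ti p)
    (z : List T) (hz : ∀ t ∈ z, owner t ≠ some i) :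
    (∀ t' ∈ z, Wm t' p = 0) ∧
    (∀ v : List T, marking M0 Wp Wm v p ≤ marking M0 Wp Wm (v ++ z) p) := by
  have h0 : ∀ t' ∈ z, Wm t' p = 0 := by
    intro t' ht'
    by_contra h
    exact hz t' ht' (hconf ti t' i ⟨p, hp, Nat.pos_of_ne_zero h⟩ hti)
  refine ⟨h0, fun v => ?_⟩
  have hs : 0 ≤ (z.map (fun t => (Wp t p : ℤ) - (Wm t p : ℤ))).sum := by
    apply List.sum_nonneg
    intro x hx
    obtain ⟨t, ht, rfl⟩ := List.mem_map.mp hx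
    simp [h0 t ht]
  unfold marking
  rw [List.map_append, List.sum_append]
  linarith
end
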